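/- arXiv:2006.09614 — 11 statements merged into one kernel-verified Lean document; each statement's English description precedes it below -/
import Mathlib

section
/- Fix a final time t_f > 0, vectors r_0, r_f, v_{g0}, v_{gf} in ℝ³, a continuously differentiable wind velocity w : ℝ → ℝ³, and set v_{a0} = v_{g0} − w(0), v_{af} = v_{gf} − w(t_f), I_{wf} = ∫₀^{t_f} w(τ) dτ. Define u*(t) = (2/t_f³)[(r_0 − r_f + I_{wf})(6t − 3t_f) + v_{a0} t_f (3t − 2t_f) + v_{af} t_f (3t − t_f)]. Then among all continuous controls u : [0, t_f] → ℝ³ whose trajectory r(t) = r_0 + ∫₀^t v_g(τ)dτ, v_g(t) = v_{g0} + ∫₀^t (u(τ) + w'(τ))dτ satisfies the rendez-vous boundary conditions r(t_f) = r_f and v_g(t_f) = v_{gf}, the control u* achieves the minimum of the energy ∫₀^{t_f} ½‖u(t)‖² dt. -/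
theorem ContinuousOn.continuousOn_integral_Icc
    {E : Type*} [NormedAddCommGroup E] [NormedSpace ℝ E]
    {a b : ℝ} (hab : a ≤ b) {u : ℝ → E} (hu : ContinuousOn u (Set.Icc a b)) :
    ContinuousOn (fun t => ∫ τ in a..t, u τ) (Set.Icc a b) := by
  rw [← Set.uIcc_of_le hab] at hu ⊢
  exact intervalIntegral.continuousOn_primitive_interval
    (hu.integrableOn_compact isCompact_uIcc)

open intervalIntegral in
/-- Cauchy's formula for repeated integration, for the second primitive. -/
theorem integral_primitive_eq_integral_sub_smul
    {E : Type*} [NormedAddCommGroup E] [NormedSpace ℝ E] [CompleteSpace E]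
    {T : ℝ} (hT : 0 ≤ T) {u : ℝ → E} (hu : ContinuousOn u (Set.Icc 0 T)) :
    ∫ t in (0:ℝ)..T, (∫ τ in (0:ℝ)..t, u τ) = ∫ t in (0:ℝ)..T, (T - t) • u t := by
  have hUc := hu.continuousOn_integral_Icc hT
  have hUi : IntervalIntegrable (fun t => ∫ τ in (0:ℝ)..t, u τ) MeasureTheory.volume 0 T :=
    hUc.intervalIntegrable_of_Icc hT
  have hlin : Continuous fun t : ℝ => T - t := by fun_prop
  have hsi : IntervalIntegrable (fun t => (T - t) • u t) MeasureTheory.volume 0 T :=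
    (hlin.continuousOn.smul hu).intervalIntegrable_of_Icc hT
  have hderiv : ∀ t ∈ Set.Ioo 0 T, HasDerivAt (fun t => (T - t) • ∫ τ in (0:ℝ)..t, u τ)
      ((T - t) • u t - ∫ τ in (0:ℝ)..t, u τ) t := by
    intro t ht
    have hU : HasDerivAt (fun t => ∫ τ in (0:ℝ)..t, u τ) (u t) t := by
      refine integral_hasDerivAt_right
        ((hu.mono (Set.Icc_subset_Icc_right ht.2.le)).intervalIntegrable_of_Icc ht.1.le)
        ((hu.mono Set.Ioo_subset_Icc_self).stronglyMeasurableAtFilter isOpen_Ioo t ht)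
        (hu.continuousAt (Icc_mem_nhds ht.1 ht.2))
    have h := ((hasDerivAt_id t).const_sub T).smul hU
    simp only [id, neg_one_smul, ← sub_eq_add_neg] at h
    exact h
  have h := integral_eq_sub_of_hasDerivAt_of_le hT (f := fun t => (T - t) • ∫ τ in (0:ℝ)..t, u τ)
    (hlin.continuousOn.smul hUc) hderiv
    (hsi.sub hUi)
  rw [integral_sub hsi hUi] at h
  simp only [sub_self, zero_smul, integral_same, smul_zero] at h
  exact (sub_eq_zero.mp h).symm

/-- The velocity reached at time `t ∈ [0, T]` under a continuous control `u` and a wind `w`. -/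
theorem integral_control_add_deriv_wind
    {E : Type*} [NormedAddCommGroup E] [NormedSpace ℝ E] [CompleteSpace E]
    {T : ℝ} {u w : ℝ → E} (hu : ContinuousOn u (Set.Icc 0 T)) (hw : ContDiff ℝ 1 w)
    {t : ℝ} (ht : t ∈ Set.Icc 0 T) :
    ∫ τ in (0:ℝ)..t, (u τ + deriv w τ) = (∫ τ in (0:ℝ)..t, u τ) + (w t - w 0) := by
  have hdw : IntervalIntegrable (deriv w) MeasureTheory.volume 0 t :=
    (hw.continuous_deriv le_rfl).intervalIntegrable _ _
  rw [intervalIntegral.integral_add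
    ((hu.mono (Set.Icc_subset_Icc_right ht.2)).intervalIntegrable_of_Icc ht.1) hdw,
    intervalIntegral.integral_deriv_eq_sub
      (fun x _ => (hw.differentiable one_ne_zero).differentiableAt) hdw]

/-- The position reached at time `T` depends on the control only through its first moment. -/
theorem integral_velocity_eq
    {E : Type*} [NormedAddCommGroup E] [NormedSpace ℝ E] [CompleteSpace E]
    {T : ℝ} (hT : 0 ≤ T) {u w vg : ℝ → E} {vg0 : E} (hu : ContinuousOn u (Set.Icc 0 T))
    (hw : ContDiff ℝ 1 w) (hvg : ∀ t, vg t = vg0 + ∫ τ in (0:ℝ)..t, (u τ + deriv w τ)) :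
    ∫ t in (0:ℝ)..T, vg t =
      T • (vg0 - w 0) + (∫ t in (0:ℝ)..T, w t) + ∫ t in (0:ℝ)..T, (T - t) • u t := by
  have hwi : IntervalIntegrable w MeasureTheory.volume 0 T :=
    hw.continuous.intervalIntegrable _ _
  have hc : IntervalIntegrable (fun _ : ℝ => vg0 - w 0) MeasureTheory.volume 0 T :=
    intervalIntegrable_const
  have hcongr : ∫ t in (0:ℝ)..T, vg t =
      ∫ t in (0:ℝ)..T, ((vg0 - w 0) + w t + ∫ τ in (0:ℝ)..t, u τ) := by
    refine intervalIntegral.integral_congr fun t ht => ?_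
    rw [Set.uIcc_of_le hT] at ht
    simp only [hvg t, integral_control_add_deriv_wind hu hw ht]
    abel
  rw [hcongr, intervalIntegral.integral_add (hc.add hwi) ((hu.continuousOn_integral_Icc hT).intervalIntegrable_of_Icc hT),
    intervalIntegral.integral_add hc hwi, intervalIntegral.integral_const, sub_zero,
    integral_primitive_eq_integral_sub_smul hT hu]

theorem integral_affine {E : Type*} [NormedAddCommGroup E] [NormedSpace ℝ E] [CompleteSpace E]
    (T : ℝ) (a b : E) :
    ∫ t in (0:ℝ)..T, (a + (T - t) • b) = T • a + (T ^ 2 / 2) • b := by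
  have h : ∫ t in (0:ℝ)..T, (T - t) = T ^ 2 / 2 := by
    rw [intervalIntegral.integral_comp_sub_left (fun x => x) T]
    simp
  rw [intervalIntegral.integral_add intervalIntegrable_const
      (Continuous.intervalIntegrable (by fun_prop) _ _),
    intervalIntegral.integral_smul_const, h]
  simp

theorem integral_sub_smul_affine
    {E : Type*} [NormedAddCommGroup E] [NormedSpace ℝ E] [CompleteSpace E] (T : ℝ) (a b : E) :
    ∫ t in (0:ℝ)..T, (T - t) • (a + (T - t) • b) = (T ^ 2 / 2) • a + (T ^ 3 / 3) • b := by
  have h1 : ∫ t in (0:ℝ)..T, (T - t) = T ^ 2 / 2 := by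
    rw [intervalIntegral.integral_comp_sub_left (fun x => x) T]
    simp
  have h2 : ∫ t in (0:ℝ)..T, (T - t) ^ 2 = T ^ 3 / 3 := by
    rw [intervalIntegral.integral_comp_sub_left (fun x => x ^ 2) T]
    norm_num
  simp only [smul_add, smul_smul, ← pow_two]
  rw [intervalIntegral.integral_add (Continuous.intervalIntegrable (by fun_prop) _ _)
      (Continuous.intervalIntegrable (by fun_prop) _ _),
    intervalIntegral.integral_smul_const, intervalIntegral.integral_smul_const, h1, h2]

/-- An affine control has the least energy among the continuous controls with the same
zeroth and first moments. -/
theorem energy_affine_le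
    {E : Type*} [NormedAddCommGroup E] [InnerProductSpace ℝ E] [CompleteSpace E]
    {T : ℝ} (hT : 0 ≤ T) {a b : E} {u : ℝ → E} (hu : ContinuousOn u (Set.Icc 0 T))
    (h0 : ∫ t in (0:ℝ)..T, u t = ∫ t in (0:ℝ)..T, (a + (T - t) • b))
    (h1 : ∫ t in (0:ℝ)..T, (T - t) • u t = ∫ t in (0:ℝ)..T, (T - t) • (a + (T - t) • b)) :
    ∫ t in (0:ℝ)..T, (1/2) * ‖a + (T - t) • b‖ ^ 2 ≤ ∫ t in (0:ℝ)..T, (1/2) * ‖u t‖ ^ 2 := by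
  set p : ℝ → E := fun t => a + (T - t) • b with hp
  have hpc : Continuous p := by fun_prop
  have hlin : Continuous fun t : ℝ => T - t := by fun_prop
  have hui := hu.intervalIntegrable_of_Icc (μ := MeasureTheory.volume) hT
  have hpi := hpc.intervalIntegrable (μ := MeasureTheory.volume) 0 T
  have hsu : IntervalIntegrable (fun t => (T - t) • u t) MeasureTheory.volume 0 T :=
    (hlin.continuousOn.smul hu).intervalIntegrable_of_Icc hT
  have hsp : IntervalIntegrable (fun t => (T - t) • p t) MeasureTheory.volume 0 T :=
    (hlin.smul hpc).intervalIntegrable 0 T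
  have hd0 : ∫ t in (0:ℝ)..T, (u t - p t) = 0 := by
    rw [intervalIntegral.integral_sub hui hpi, h0, sub_self]
  have hd1 : ∫ t in (0:ℝ)..T, ((T - t) • u t - (T - t) • p t) = 0 := by
    rw [intervalIntegral.integral_sub hsu hsp, h1, sub_self]
  have ha := (innerSL ℝ a).intervalIntegral_comp_comm (hui.sub hpi)
  have hb := (innerSL ℝ b).intervalIntegral_comp_comm (hsu.sub hsp)
  rw [hd0, map_zero] at ha
  rw [hd1, map_zero] at hb
  have hpe : IntervalIntegrable (fun t => (1/2) * ‖p t‖ ^ 2) MeasureTheory.volume 0 T :=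
    Continuous.intervalIntegrable (by fun_prop) _ _
  have hue : IntervalIntegrable (fun t => (1/2) * ‖u t‖ ^ 2) MeasureTheory.volume 0 T :=
    ContinuousOn.intervalIntegrable_of_Icc hT (by fun_prop)
  have hai : IntervalIntegrable (fun t => innerSL ℝ a (u t - p t)) MeasureTheory.volume 0 T :=
    ContinuousOn.intervalIntegrable_of_Icc hT (by fun_prop)
  have hbi : IntervalIntegrable (fun t => innerSL ℝ b ((T - t) • u t - (T - t) • p t))
      MeasureTheory.volume 0 T :=
    ContinuousOn.intervalIntegrable_of_Icc hT (by fun_prop)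
  calc ∫ t in (0:ℝ)..T, (1/2) * ‖p t‖ ^ 2
      = ∫ t in (0:ℝ)..T, ((1/2) * ‖p t‖ ^ 2 + innerSL ℝ a (u t - p t)
          + innerSL ℝ b ((T - t) • u t - (T - t) • p t)) := by
        rw [intervalIntegral.integral_add (hpe.add hai) hbi,
          intervalIntegral.integral_add hpe hai, ha, hb, add_zero, add_zero]
    _ ≤ ∫ t in (0:ℝ)..T, (1/2) * ‖u t‖ ^ 2 := by
        refine intervalIntegral.integral_mono_on hT ((hpe.add hai).add hbi) hue fun t _ => ?_
        have hinner : innerSL ℝ a (u t - p t) + innerSL ℝ b ((T - t) • u t - (T - t) • p t)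
            = inner ℝ (p t) (u t - p t) := by
          rw [← smul_sub]
          simp only [innerSL_apply_apply, hp, inner_add_left, inner_smul_left, inner_smul_right]
          simp
        have hsq := norm_add_sq_real (p t) (u t - p t)
        rw [add_sub_cancel] at hsq
        nlinarith [sq_nonneg ‖u t - p t‖]

/-- For a fixed final time `tf > 0`, boundary data `r0, rf, vg0, vgf` and a
continuously differentiable wind `w`, the control `u*` given by the closed-form expression
achieves the minimum control energy `∫₀^tf ½‖u‖²` among all continuous controls whose
trajectory satisfies the rendez-vous boundary conditions `r tf = rf` and `vg tf = vgf`. -/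
theorem statement_0
    (tf : ℝ) (htf : 0 < tf)
    (r0 rf vg0 vgf : EuclideanSpace ℝ (Fin 3))
    (w : ℝ → EuclideanSpace ℝ (Fin 3)) (hw : ContDiff ℝ 1 w)
    (va0 vaf Iwf : EuclideanSpace ℝ (Fin 3))
    (hva0 : va0 = vg0 - w 0) (hvaf : vaf = vgf - w tf)
    (hIwf : Iwf = ∫ τ in (0:ℝ)..tf, w τ)
    (ustar : ℝ → EuclideanSpace ℝ (Fin 3))
    (hustar : ∀ t, ustar t =
      (2 / tf ^ 3) • ((6 * t - 3 * tf) • (r0 - rf + Iwf)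
        + (tf * (3 * t - 2 * tf)) • va0 + (tf * (3 * t - tf)) • vaf))
    (vgstar rstar : ℝ → EuclideanSpace ℝ (Fin 3))
    (hvgstar : ∀ t, vgstar t = vg0 + ∫ τ in (0:ℝ)..t, (ustar τ + deriv w τ))
    (hrstar : ∀ t, rstar t = r0 + ∫ τ in (0:ℝ)..t, vgstar τ) :
    (rstar tf = rf ∧ vgstar tf = vgf) ∧
    ∀ (u vg r : ℝ → EuclideanSpace ℝ (Fin 3)),
      ContinuousOn u (Set.Icc 0 tf) →
      (∀ t, vg t = vg0 + ∫ τ in (0:ℝ)..t, (u τ + deriv w τ)) →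
      (∀ t, r t = r0 + ∫ τ in (0:ℝ)..t, vg τ) →
      r tf = rf → vg tf = vgf →
      (∫ t in (0:ℝ)..tf, (1/2) * ‖ustar t‖ ^ 2)
        ≤ ∫ t in (0:ℝ)..tf, (1/2) * ‖u t‖ ^ 2 := by
  have hT : tf ≠ 0 := htf.ne'
  obtain ⟨a, b, ha, hb⟩ : ∃ a b : EuclideanSpace ℝ (Fin 3),
      a = (2 / tf ^ 3) • ((3 * tf) • (r0 - rf + Iwf) + (tf ^ 2) • va0 + (2 * tf ^ 2) • vaf) ∧
      b = (2 / tf ^ 3) • ((-6 : ℝ) • (r0 - rf + Iwf) - (3 * tf) • va0 - (3 * tf) • vaf) :=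
    ⟨_, _, rfl, rfl⟩
  have hu : ustar = fun t => a + (tf - t) • b := by
    funext t
    rw [hustar, ha, hb]
    module
  have huc : Continuous ustar := by rw [hu]; fun_prop
  have hm0 : ∫ t in (0:ℝ)..tf, ustar t = vaf - va0 := by
    simp only [hu]
    rw [integral_affine, ha, hb]
    match_scalars <;> field_simp <;> ring
  have hm1 : ∫ t in (0:ℝ)..tf, (tf - t) • ustar t = rf - r0 - Iwf - tf • va0 := by
    simp only [hu]
    rw [integral_sub_smul_affine, ha, hb]
    match_scalars <;> field_simp <;> ring
  have hend : tf ∈ Set.Icc 0 tf := ⟨htf.le, le_rfl⟩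
  refine ⟨⟨?_, ?_⟩, ?_⟩
  · rw [hrstar, integral_velocity_eq htf.le huc.continuousOn hw hvgstar, hm1, ← hva0, ← hIwf]
    abel
  · rw [hvgstar, integral_control_add_deriv_wind huc.continuousOn hw hend, hm0, hva0, hvaf]
    abel
  · intro u vg r huo hvg hr hrf hvgf
    have h0 : ∫ t in (0:ℝ)..tf, u t = ∫ t in (0:ℝ)..tf, ustar t := by
      rw [hvg, integral_control_add_deriv_wind huo hw hend] at hvgf
      rw [hm0, hvaf, hva0, ← hvgf]
      abel
    have h1 : ∫ t in (0:ℝ)..tf, (tf - t) • u t = ∫ t in (0:ℝ)..tf, (tf - t) • ustar t := by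
      rw [hr, integral_velocity_eq htf.le huo hw hvg, ← hva0, ← hIwf] at hrf
      rw [hm1, ← hrf]
      abel
    simp only [hu] at h0 h1 ⊢
    exact energy_affine_le htf.le huo h0 h1
end

section
/- Fix t_f > 0, vectors r_0, r_f, v_{g0}, v_{gf} in ℝ³, a continuously differentiable wind w : ℝ → ℝ³, and set v_{a0} = v_{g0} − w(0), v_{af} = v_{gf} − w(t_f), I_{wf} = ∫₀^{t_f} w(τ) dτ. Let u*(t) = (2/t_f³)[(r_0 − r_f + I_{wf})(6t − 3t_f) + v_{a0} t_f (3t − 2t_f) + v_{af} t_f (3t − t_f)], and define the trajectory v_g(t) = v_{g0} + ∫₀^t (u*(τ) + w'(τ))dτ and r(t) = r_0 + ∫₀^t v_g(τ)dτ. Then this trajectory is feasible for the rendez-vous problem: r(t_f) = r_f and v_g(t_f) = v_{gf}. -/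
/-- The derivative of a combination of three fixed vectors with
differentiable scalar coefficients. -/
theorem hasDerivAt_smul_add_smul_add_smul {E : Type*} [NormedAddCommGroup E] [NormedSpace ℝ E]
    {f g h : ℝ → ℝ} {f' g' h' t : ℝ} (c : ℝ) (a b d : E)
    (hf : HasDerivAt f f' t) (hg : HasDerivAt g g' t) (hh : HasDerivAt h h' t) :
    HasDerivAt (fun x => c • (f x • a + g x • b + h x • d)) (c • (f' • a + g' • b + h' • d)) t :=
  (((hf.smul_const a).add (hg.smul_const b)).add (hh.smul_const d)).const_smul c

theorem hasDerivAt_cubic (a b c t : ℝ) :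
    HasDerivAt (fun x : ℝ => a * x ^ 3 + b * x ^ 2 + c * x) (3 * a * t ^ 2 + 2 * b * t + c) t := by
  have h := (((hasDerivAt_pow 3 t).const_mul a).add ((hasDerivAt_pow 2 t).const_mul b)).add
    ((hasDerivAt_id' t).const_mul c)
  exact h.congr_deriv (by push_cast; ring)


/-- The trajectory generated by the optimal rendez-vous control `u*` is feasible:
it satisfies the terminal conditions `r tf = rf` and `vg tf = vgf`. -/
theorem statement_1
    (tf : ℝ) (htf : 0 < tf)
    (r0 rf vg0 vgf : EuclideanSpace ℝ (Fin 3))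
    (w : ℝ → EuclideanSpace ℝ (Fin 3)) (hw : ContDiff ℝ 1 w)
    (va0 vaf Iwf : EuclideanSpace ℝ (Fin 3))
    (hva0 : va0 = vg0 - w 0) (hvaf : vaf = vgf - w tf)
    (hIwf : Iwf = ∫ τ in (0:ℝ)..tf, w τ)
    (ustar : ℝ → EuclideanSpace ℝ (Fin 3))
    (hustar : ∀ t, ustar t =
      (2 / tf ^ 3) • ((6 * t - 3 * tf) • (r0 - rf + Iwf)
        + (tf * (3 * t - 2 * tf)) • va0 + (tf * (3 * t - tf)) • vaf))
    (vg r : ℝ → EuclideanSpace ℝ (Fin 3))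
    (hvg : ∀ t, vg t = vg0 + ∫ τ in (0:ℝ)..t, (ustar τ + deriv w τ))
    (hr : ∀ t, r t = r0 + ∫ τ in (0:ℝ)..t, vg τ) :
    r tf = rf ∧ vg tf = vgf := by
  have hw' : ∀ t, HasDerivAt w (deriv w t) t := fun t =>
    (hw.differentiable one_ne_zero t).hasDerivAt
  have hu : Continuous ustar := by
    rw [funext hustar]
    fun_prop
  have hvg' : ∀ t, vg t = va0 + w t + (2 / tf ^ 3) • ((3 * t ^ 2 - 3 * tf * t) • (r0 - rf + Iwf)
      + (tf * (3 / 2 * t ^ 2 - 2 * tf * t)) • va0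
      + (tf * (3 / 2 * t ^ 2 - tf * t)) • vaf) := by
    intro t
    have key := intervalIntegral.integral_eq_sub_of_hasDerivAt (a := 0) (b := t)
      (f := fun t => (2 / tf ^ 3) • ((0 * t ^ 3 + 3 * t ^ 2 + (-3 * tf) * t) • (r0 - rf + Iwf)
        + (0 * t ^ 3 + (3 / 2 * tf) * t ^ 2 + (-2 * tf ^ 2) * t) • va0
        + (0 * t ^ 3 + (3 / 2 * tf) * t ^ 2 + (-tf ^ 2) * t) • vaf) + w t)
      (f' := fun τ => ustar τ + deriv w τ)
      (fun τ _ => by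
        refine HasDerivAt.add ?_ (hw' τ)
        convert hasDerivAt_smul_add_smul_add_smul (2 / tf ^ 3) (r0 - rf + Iwf) va0 vaf
          (hasDerivAt_cubic 0 3 (-3 * tf) τ)
          (hasDerivAt_cubic 0 (3 / 2 * tf) (-2 * tf ^ 2) τ)
          (hasDerivAt_cubic 0 (3 / 2 * tf) (-tf ^ 2) τ) using 1
        rw [hustar]
        module)
      ((hu.add (hw.continuous_deriv le_rfl)).intervalIntegrable _ _)
    rw [hvg, key, hva0]
    module
  have hint : ∫ τ in (0:ℝ)..tf, vg τ = rf - r0 := by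
    have key := intervalIntegral.integral_eq_sub_of_hasDerivAt (a := 0) (b := tf)
      (f := fun t => (2 / tf ^ 3) • ((1 * t ^ 3 + (-3 / 2 * tf) * t ^ 2 + 0 * t) • (r0 - rf + Iwf)
        + (tf / 2 * t ^ 3 + (-tf ^ 2) * t ^ 2 + (tf ^ 3 / 2) * t) • va0
        + (tf / 2 * t ^ 3 + (-tf ^ 2 / 2) * t ^ 2 + 0 * t) • vaf) + ∫ τ in (0:ℝ)..t, w τ)
      (f' := vg)
      (fun τ _ => by
        have h := hasDerivAt_smul_add_smul_add_smul (2 / tf ^ 3) (r0 - rf + Iwf) va0 vaf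
          (hasDerivAt_cubic 1 (-3 / 2 * tf) 0 τ)
          (hasDerivAt_cubic (tf / 2) (-tf ^ 2) (tf ^ 3 / 2) τ)
          (hasDerivAt_cubic (tf / 2) (-tf ^ 2 / 2) 0 τ)
        refine (h.add (hw.continuous.integral_hasStrictDerivAt 0 τ).hasDerivAt).congr_deriv ?_
        rw [hvg']
        match_scalars <;> field_simp <;> ring)
      (by
        refine Continuous.intervalIntegrable ?_ _ _
        have := hw.continuous
        rw [funext hvg']
        fun_prop)
    rw [key, intervalIntegral.integral_same, ← hIwf]
    match_scalars <;> field_simp <;> ring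
  refine ⟨?_, ?_⟩
  · rw [hr, hint]
    module
  · have hend : vg tf = w tf + vaf := by
      rw [hvg']
      match_scalars <;> field_simp <;> ring
    rw [hend, hvaf]
    module
end

section
/- Fix t_f > 0, vectors r_0, r_f, v_{g0}, v_{gf} in ℝ³, a continuously differentiable wind w : ℝ → ℝ³, a constant C_I ≥ 0, and set v_{a0} = v_{g0} − w(0), v_{af} = v_{gf} − w(t_f), I_{wf} = ∫₀^{t_f} w(τ) dτ. For the optimal rendez-vous control u*(t) = (2/t_f³)[(r_0 − r_f + I_{wf})(6t − 3t_f) + v_{a0} t_f (3t − 2t_f) + v_{af} t_f (3t − t_f)], the optimal cost equals ∫₀^{t_f} (½‖u*(t)‖² + C_I) dt = C_I t_f + a_1 t_f^{−1} + a_2 t_f^{−2} + a_3 t_f^{−3}, where a_1 = 2(‖v_{a0}‖² + ‖v_{af}‖² + ⟨v_{a0}, v_{af}⟩), a_2 = 6⟨r_0 − r_f + I_{wf}, v_{a0} + v_{af}⟩, and a_3 = 6‖r_0 − r_f + I_{wf}‖². -/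
open scoped RealInnerProductSpace

/-- The integral of a quadratic polynomial over `[0, b]`. -/
theorem integral_quadratic (b c₀ c₁ c₂ : ℝ) :
    ∫ t in (0 : ℝ)..b, (c₀ + c₁ * t + c₂ * t ^ 2) = c₀ * b + c₁ * b ^ 2 / 2 + c₂ * b ^ 3 / 3 := by
  have hderiv (t : ℝ) : HasDerivAt (fun t : ℝ => c₀ * t + c₁ * t ^ 2 / 2 + c₂ * t ^ 3 / 3)
      (c₀ + c₁ * t + c₂ * t ^ 2) t := by
    refine ((((hasDerivAt_id t).const_mul c₀).add
      (((hasDerivAt_pow 2 t).const_mul c₁).div_const 2)).add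
      (((hasDerivAt_pow 3 t).const_mul c₂).div_const 3)).congr_deriv ?_
    push_cast
    ring
  rw [intervalIntegral.integral_eq_sub_of_hasDerivAt (fun t _ => hderiv t)
    (Continuous.intervalIntegrable (by fun_prop) _ _)]
  ring

/-- The squared norm of a linear combination of three vectors. -/
theorem norm_sq_smul_add_smul_add_smul {E : Type*} [NormedAddCommGroup E] [InnerProductSpace ℝ E]
    (a b c : ℝ) (x y z : E) :
    ‖a • x + b • y + c • z‖ ^ 2 = a ^ 2 * ‖x‖ ^ 2 + b ^ 2 * ‖y‖ ^ 2 + c ^ 2 * ‖z‖ ^ 2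
      + 2 * (a * b * ⟪x, y⟫ + a * c * ⟪x, z⟫ + b * c * ⟪y, z⟫) := by
  simp only [norm_add_sq_real, inner_add_left, real_inner_smul_left, real_inner_smul_right,
    norm_smul, mul_pow, Real.norm_eq_abs, sq_abs]
  ring

/-- The cost of the optimal rendez-vous control `u*` equals
`C_I t_f + a₁ t_f⁻¹ + a₂ t_f⁻² + a₃ t_f⁻³` with the stated coefficients. -/
theorem statement_2
    (tf : ℝ) (htf : 0 < tf)
    (r0 rf vg0 vgf : EuclideanSpace ℝ (Fin 3))
    (w : ℝ → EuclideanSpace ℝ (Fin 3)) (hw : ContDiff ℝ 1 w)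
    (CI : ℝ) (hCI : 0 ≤ CI)
    (va0 vaf Iwf : EuclideanSpace ℝ (Fin 3))
    (hva0 : va0 = vg0 - w 0) (hvaf : vaf = vgf - w tf)
    (hIwf : Iwf = ∫ τ in (0:ℝ)..tf, w τ)
    (ustar : ℝ → EuclideanSpace ℝ (Fin 3))
    (hustar : ∀ t, ustar t =
      (2 / tf ^ 3) • ((6 * t - 3 * tf) • (r0 - rf + Iwf)
        + (tf * (3 * t - 2 * tf)) • va0 + (tf * (3 * t - tf)) • vaf))
    (a1 a2 a3 : ℝ)
    (ha1 : a1 = 2 * (‖va0‖ ^ 2 + ‖vaf‖ ^ 2 + ⟪va0, vaf⟫))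
    (ha2 : a2 = 6 * ⟪r0 - rf + Iwf, va0 + vaf⟫)
    (ha3 : a3 = 6 * ‖r0 - rf + Iwf‖ ^ 2) :
    (∫ t in (0:ℝ)..tf, ((1/2) * ‖ustar t‖ ^ 2 + CI))
      = CI * tf + a1 / tf + a2 / tf ^ 2 + a3 / tf ^ 3 := by
  rw [ha1, ha2, ha3]
  generalize r0 - rf + Iwf = A at *
  have hquad (t : ℝ) : (1 / 2) * ‖ustar t‖ ^ 2 + CI =
      (2 / tf ^ 6 * (9 * tf ^ 2 * ‖A‖ ^ 2 + 4 * tf ^ 4 * ‖va0‖ ^ 2 + tf ^ 4 * ‖vaf‖ ^ 2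
        + 2 * (6 * tf ^ 3 * ⟪A, va0⟫ + 3 * tf ^ 3 * ⟪A, vaf⟫ + 2 * tf ^ 4 * ⟪va0, vaf⟫)) + CI)
      + (2 / tf ^ 6 * (-36 * tf * ‖A‖ ^ 2 - 12 * tf ^ 3 * ‖va0‖ ^ 2 - 6 * tf ^ 3 * ‖vaf‖ ^ 2
        + 2 * (-21 * tf ^ 2 * ⟪A, va0⟫ - 15 * tf ^ 2 * ⟪A, vaf⟫
          - 9 * tf ^ 3 * ⟪va0, vaf⟫))) * t
      + (2 / tf ^ 6 * (36 * ‖A‖ ^ 2 + 9 * tf ^ 2 * ‖va0‖ ^ 2 + 9 * tf ^ 2 * ‖vaf‖ ^ 2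
        + 2 * (18 * tf * ⟪A, va0⟫ + 18 * tf * ⟪A, vaf⟫ + 9 * tf ^ 2 * ⟪va0, vaf⟫))) * t ^ 2 := by
    rw [hustar, norm_smul, mul_pow, norm_sq_smul_add_smul_add_smul, Real.norm_eq_abs, sq_abs]
    ring
  simp only [hquad]
  rw [integral_quadratic, inner_add_right]
  field_simp
  ring
end

section
/- Fix t_f > 0, vectors r_0, r_f, v_{g0}, v_{gf}, w_0, k in ℝ³, and let the wind be the constantly accelerating profile w(t) = w_0 + k t. Then, with v_{a0} = v_{g0} − w(0), v_{af} = v_{gf} − w(t_f), I_{wf} = ∫₀^{t_f} w(τ) dτ = w_0 t_f + ½ k t_f², the rendez-vous optimal control u*(t) = (2/t_f³)[(r_0 − r_f + I_{wf})(6t − 3t_f) + v_{a0} t_f (3t − 2t_f) + v_{af} t_f (3t − t_f)] is equal, for every t, to (2/t_f³)[(r_0 − r_f)(6t − 3t_f) + v_{g0} t_f (3t − 2t_f) + v_{gf} t_f (3t − t_f)] − k. -/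
/-- The integral of an affine curve over `[0, a]`. -/
theorem intervalIntegral_affine {E : Type*} [NormedAddCommGroup E] [NormedSpace ℝ E]
    [CompleteSpace E] (a : ℝ) (x y : E) :
    ∫ τ in (0 : ℝ)..a, (x + τ • y) = a • x + (a ^ 2 / 2) • y := by
  rw [intervalIntegral.integral_add (by simp)
    (Continuous.intervalIntegrable (by fun_prop) _ _),
    intervalIntegral.integral_smul_const]
  simp

/-- For a constantly accelerating wind `w(t) = w₀ + k t`, we have
`I_wf = w₀ t_f + ½ k t_f²` and the rendez-vous optimal control written in terms of the
relative (air) velocities coincides with the ground-velocity form minus `k`. -/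
theorem statement_4
    (tf : ℝ) (htf : 0 < tf)
    (r0 rf vg0 vgf w0 k : EuclideanSpace ℝ (Fin 3))
    (w : ℝ → EuclideanSpace ℝ (Fin 3)) (hw : ∀ t, w t = w0 + t • k)
    (va0 vaf Iwf : EuclideanSpace ℝ (Fin 3))
    (hva0 : va0 = vg0 - w 0) (hvaf : vaf = vgf - w tf)
    (hIwf : Iwf = ∫ τ in (0:ℝ)..tf, w τ) :
    Iwf = tf • w0 + (tf ^ 2 / 2) • k ∧
    ∀ t,
      (2 / tf ^ 3) • ((6 * t - 3 * tf) • (r0 - rf + Iwf)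
        + (tf * (3 * t - 2 * tf)) • va0 + (tf * (3 * t - tf)) • vaf)
      = (2 / tf ^ 3) • ((6 * t - 3 * tf) • (r0 - rf)
        + (tf * (3 * t - 2 * tf)) • vg0 + (tf * (3 * t - tf)) • vgf) - k := by
  have hI : Iwf = tf • w0 + (tf ^ 2 / 2) • k := by
    simp only [hIwf, hw, intervalIntegral_affine]
  refine ⟨hI, fun t => ?_⟩
  rw [hva0, hvaf, hI, hw, hw]
  have htf0 : tf ≠ 0 := htf.ne'
  match_scalars <;> field_simp <;> ring
end

section
/- Fix t_f > 0, vectors r_0, r_f, v_{g0}, w_0, k in ℝ³, let the wind be w(t) = w_0 + k t, and set Δ_r = r_0 − r_f. Define u*(t) = (t − t_f) · (3/t_f³) [Δ_r + v_{g0} t_f + (k/2) t_f²]. Then among all continuous controls u : [0, t_f] → ℝ³ whose trajectory r(t) = r_0 + ∫₀^t v_g(τ)dτ, v_g(t) = v_{g0} + ∫₀^t (u(τ) + k)dτ satisfies the intercept condition r(t_f) = r_f (terminal velocity free), the control u* achieves the minimum of the energy ∫₀^{t_f} ½‖u(t)‖² dt. -/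
theorem intervalIntegrable_of_continuousOn_Icc {E : Type*} [NormedAddCommGroup E] {a b : ℝ}
    (hab : a ≤ b) {f : ℝ → E} (hf : ContinuousOn f (Set.Icc a b)) :
    IntervalIntegrable f MeasureTheory.volume a b :=
  ContinuousOn.intervalIntegrable (by rwa [Set.uIcc_of_le hab])

theorem integral_integral_eq_integral_sub_smul {E : Type*} [NormedAddCommGroup E]
    [NormedSpace ℝ E] [CompleteSpace E] {T : ℝ} (hT : 0 ≤ T) {f : ℝ → E}
    (hf : ContinuousOn f (Set.Icc 0 T)) :
    ∫ t in (0:ℝ)..T, ∫ s in (0:ℝ)..t, f s = ∫ t in (0:ℝ)..T, (T - t) • f t := by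
  wlog hc : Continuous f generalizing f
  · set g : ℝ → E := Set.IccExtend hT ((Set.Icc 0 T).domRestrict f) with hg
    have hgc : Continuous g := hf.domRestrict.Icc_extend'
    have hfg : ∀ t ∈ Set.Icc 0 T, f t = g t := fun t ht => by
      rw [hg, Set.IccExtend_of_mem hT _ ht]
      rfl
    have hinner : ∀ t ∈ Set.Icc 0 T, ∫ s in (0:ℝ)..t, f s = ∫ s in (0:ℝ)..t, g s := fun t ht =>
      intervalIntegral.integral_congr fun s hs => by
        rw [Set.uIcc_of_le ht.1] at hs
        exact hfg s ⟨hs.1, hs.2.trans ht.2⟩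
    calc _ = ∫ t in (0:ℝ)..T, ∫ s in (0:ℝ)..t, g s :=
          intervalIntegral.integral_congr fun t ht => hinner t (by rwa [Set.uIcc_of_le hT] at ht)
      _ = ∫ t in (0:ℝ)..T, (T - t) • g t := this hgc.continuousOn hgc
      _ = _ := intervalIntegral.integral_congr fun t ht => by
          rw [Set.uIcc_of_le hT] at ht
          simp only [hfg t ht]
  have hV : ∀ t, HasDerivAt (fun t => ∫ s in (0:ℝ)..t, f s) (f t) t := fun t =>
    intervalIntegral.integral_hasDerivAt_right (hc.intervalIntegrable _ _)
      hc.stronglyMeasurable.stronglyMeasurableAtFilter hc.continuousAt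
  have hVc : Continuous fun t => ∫ s in (0:ℝ)..t, f s :=
    continuous_iff_continuousAt.2 fun t => (hV t).continuousAt
  have hwc : Continuous fun t => (T - t) • f t := by fun_prop
  have hF : ∀ t, HasDerivAt (fun t => (T - t) • ∫ s in (0:ℝ)..t, f s)
      ((T - t) • f t - ∫ s in (0:ℝ)..t, f s) t := fun t => by
    have h := ((hasDerivAt_id t).const_sub T).smul (hV t)
    rw [neg_one_smul, ← sub_eq_add_neg] at h
    exact h
  have h := intervalIntegral.integral_eq_sub_of_hasDerivAt (fun t _ => hF t)
    ((hwc.sub hVc).intervalIntegrable 0 T)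
  rw [intervalIntegral.integral_sub (hwc.intervalIntegrable _ _) (hVc.intervalIntegrable _ _)] at h
  simp only [sub_self, zero_smul, intervalIntegral.integral_same, smul_zero] at h
  exact (sub_eq_zero.1 h).symm

theorem integral_sub_pow (T : ℝ) (n : ℕ) :
    ∫ t in (0:ℝ)..T, (T - t) ^ n = T ^ (n + 1) / (n + 1) := by
  rw [intervalIntegral.integral_comp_sub_left (fun t => t ^ n) T]
  simp

theorem terminal_position_eq {E : Type*} [NormedAddCommGroup E] [NormedSpace ℝ E]
    [CompleteSpace E] {T : ℝ} (hT : 0 ≤ T) {r₀ v₀ k : E} {u v r : ℝ → E}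
    (hu : ContinuousOn u (Set.Icc 0 T))
    (hv : ∀ t, v t = v₀ + ∫ s in (0:ℝ)..t, (u s + k))
    (hr : ∀ t, r t = r₀ + ∫ s in (0:ℝ)..t, v s) :
    r T = r₀ + T • v₀ + (T ^ 2 / 2) • k + ∫ t in (0:ℝ)..T, (T - t) • u t := by
  have huk : ContinuousOn (fun t => u t + k) (Set.Icc 0 T) := hu.add continuousOn_const
  have hint : IntervalIntegrable (fun t => ∫ s in (0:ℝ)..t, (u s + k))
      MeasureTheory.volume 0 T := by
    refine ContinuousOn.intervalIntegrable (intervalIntegral.continuousOn_primitive_interval ?_)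
    rw [Set.uIcc_of_le hT]
    exact huk.integrableOn_Icc
  have hwu := intervalIntegrable_of_continuousOn_Icc hT (f := fun t => (T - t) • u t) (by fun_prop)
  have hwk : IntervalIntegrable (fun t => (T - t) • k) MeasureTheory.volume 0 T :=
    Continuous.intervalIntegrable (by fun_prop) _ _
  have hk : ∫ t in (0:ℝ)..T, (T - t) • k = (T ^ 2 / 2) • k := by
    have := integral_sub_pow T 1
    norm_num at this
    rw [intervalIntegral.integral_smul_const, this]
  rw [hr, show v = _ from funext hv, intervalIntegral.integral_add (by simp) hint,
    integral_integral_eq_integral_sub_smul hT huk]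
  simp only [smul_add]
  rw [intervalIntegral.integral_add hwu hwk, hk, intervalIntegral.integral_const, sub_zero]
  abel

theorem integral_energy_le_of_moment_eq {E : Type*} [NormedAddCommGroup E]
    [InnerProductSpace ℝ E] [CompleteSpace E] {T : ℝ} (hT : 0 ≤ T) {c : E} {u : ℝ → E}
    (hu : ContinuousOn u (Set.Icc 0 T))
    (hmoment : ∫ t in (0:ℝ)..T, (T - t) • u t = ∫ t in (0:ℝ)..T, (T - t) • (T - t) • c) :
    ∫ t in (0:ℝ)..T, (1 / 2) * ‖(T - t) • c‖ ^ 2 ≤ ∫ t in (0:ℝ)..T, (1 / 2) * ‖u t‖ ^ 2 := by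
  have hwu := intervalIntegrable_of_continuousOn_Icc hT (f := fun t => (T - t) • u t) (by fun_prop)
  have hwc := intervalIntegrable_of_continuousOn_Icc hT (f := fun t => (T - t) • (T - t) • c)
    (by fun_prop)
  have hcross : ∫ t in (0:ℝ)..T, innerSL ℝ c ((T - t) • u t - (T - t) • (T - t) • c) = 0 := by
    rw [ContinuousLinearMap.intervalIntegral_comp_comm _ (hwu.sub hwc),
      intervalIntegral.integral_sub hwu hwc, hmoment, sub_self, map_zero]
  have hstar := intervalIntegrable_of_continuousOn_Icc hT
    (f := fun t => (1 / 2) * ‖(T - t) • c‖ ^ 2) (by fun_prop)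
  have hinner := intervalIntegrable_of_continuousOn_Icc hT
    (f := fun t => innerSL ℝ c ((T - t) • u t - (T - t) • (T - t) • c))
    (by fun_prop)
  have henergy := intervalIntegrable_of_continuousOn_Icc hT (f := fun t => (1 / 2) * ‖u t‖ ^ 2) (by fun_prop)
  have hadd := intervalIntegral.integral_add hstar hinner
  rw [hcross, add_zero] at hadd
  rw [← hadd]
  refine intervalIntegral.integral_mono_on hT (hstar.add hinner) henergy fun t _ => ?_
  have hsq := norm_sub_sq_real (u t) ((T - t) • c)
  have hin : innerSL ℝ c ((T - t) • u t - (T - t) • (T - t) • c)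
      = inner ℝ (u t) ((T - t) • c) - ‖(T - t) • c‖ ^ 2 := by
    rw [← real_inner_self_eq_norm_sq, ← inner_sub_left, ← smul_sub, innerSL_apply_apply,
      real_inner_smul_right, real_inner_smul_right, real_inner_comm]
  rw [hin]
  linarith [sq_nonneg ‖u t - (T - t) • c‖]


/-- For the intercept problem (terminal velocity free) with wind
`w(t) = w₀ + k t`, the control `u*(t) = (t − t_f)(3/t_f³)[Δ_r + v_{g0} t_f + (k/2) t_f²]`
achieves the minimum control energy among all continuous controls whose trajectory reaches
`r(t_f) = r_f`. -/
theorem statement_7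
    (tf : ℝ) (htf : 0 < tf)
    (r0 rf vg0 w0 k : EuclideanSpace ℝ (Fin 3))
    (w : ℝ → EuclideanSpace ℝ (Fin 3)) (hw : ∀ t, w t = w0 + t • k)
    (Dr : EuclideanSpace ℝ (Fin 3)) (hDr : Dr = r0 - rf)
    (ustar : ℝ → EuclideanSpace ℝ (Fin 3))
    (hustar : ∀ t, ustar t =
      ((t - tf) * (3 / tf ^ 3)) • (Dr + tf • vg0 + (tf ^ 2 / 2) • k))
    (vgstar rstar : ℝ → EuclideanSpace ℝ (Fin 3))
    (hvgstar : ∀ t, vgstar t = vg0 + ∫ τ in (0:ℝ)..t, (ustar τ + k))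
    (hrstar : ∀ t, rstar t = r0 + ∫ τ in (0:ℝ)..t, vgstar τ) :
    rstar tf = rf ∧
    ∀ (u vg r : ℝ → EuclideanSpace ℝ (Fin 3)),
      ContinuousOn u (Set.Icc 0 tf) →
      (∀ t, vg t = vg0 + ∫ τ in (0:ℝ)..t, (u τ + k)) →
      (∀ t, r t = r0 + ∫ τ in (0:ℝ)..t, vg τ) →
      r tf = rf →
      (∫ t in (0:ℝ)..tf, (1/2) * ‖ustar t‖ ^ 2)
        ≤ ∫ t in (0:ℝ)..tf, (1/2) * ‖u t‖ ^ 2 := by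
  set c : EuclideanSpace ℝ (Fin 3) :=
    (-(3 / tf ^ 3)) • (Dr + tf • vg0 + (tf ^ 2 / 2) • k) with hc
  have hu : ustar = fun t => (tf - t) • c := funext fun t => by
    rw [hustar, hc, smul_smul]
    congr 1
    ring
  have hmoment : ∫ t in (0:ℝ)..tf, (tf - t) • ustar t
      = -(Dr + tf • vg0 + (tf ^ 2 / 2) • k) := by
    simp only [hu, smul_smul, ← pow_two]
    rw [intervalIntegral.integral_smul_const, integral_sub_pow, hc, smul_smul,
      ← neg_one_smul ℝ (Dr + tf • vg0 + (tf ^ 2 / 2) • k)]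
    congr 1
    field_simp
    norm_num [mul_comm]
  have hreach : rstar tf = rf := by
    rw [terminal_position_eq htf.le (by rw [hu]; fun_prop) hvgstar hrstar, hmoment, hDr]
    abel
  refine ⟨hreach, fun u vg r hucont hvg hr hrf => ?_⟩
  have heq := hrf.trans hreach.symm
  rw [terminal_position_eq htf.le hucont hvg hr,
    terminal_position_eq htf.le (by rw [hu]; fun_prop) hvgstar hrstar] at heq
  rw [hu] at heq ⊢
  exact integral_energy_le_of_moment_eq htf.le hucont (add_left_cancel heq)
end

section
/- Fix t_f > 0, vectors r_0, r_f, v_{g0}, w_0, k in ℝ³, let the wind be w(t) = w_0 + k t, set Δ_r = r_0 − r_f, and let u*(t) = (t − t_f)·(3/t_f³)[Δ_r + v_{g0} t_f + (k/2) t_f²] be the optimal intercept control, with trajectory v_g(t) = v_{g0} + ∫₀^t (u*(τ) + k)dτ and r(t) = r_0 + ∫₀^t v_g(τ)dτ. Then: (i) r(t_f) = r_f; (ii) u*(t_f) = 0 and u*(0) = −3[Δ_r + v_{g0} t_f]/t_f² − (3/2)k; and (iii) the (free) terminal velocity equals v_g(t_f) = v_{g0} − (3/2)[Δ_r + v_{g0}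 t_f]/t_f + (1/4) k t_f. -/
/-- A quadratic curve with coefficients in a real Banach space is integrated termwise. -/
theorem integral_quadratic_smul {E : Type*} [NormedAddCommGroup E] [NormedSpace ℝ E]
    [CompleteSpace E] (a b c : E) (t : ℝ) :
    ∫ τ in (0 : ℝ)..t, (a + τ • b + τ ^ 2 • c) =
      t • a + (t ^ 2 / 2) • b + (t ^ 3 / 3) • c := by
  have hderiv (x : ℝ) : HasDerivAt
      (fun τ : ℝ => τ • a + (τ ^ 2 / 2) • b + (τ ^ 3 / 3) • c) (a + x • b + x ^ 2 • c) x := by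
    have h₂ : HasDerivAt (fun τ : ℝ => τ ^ 2 / 2) x x :=
      ((hasDerivAt_pow 2 x).div_const 2).congr_deriv (by norm_num)
    have h₃ : HasDerivAt (fun τ : ℝ => τ ^ 3 / 3) (x ^ 2) x :=
      ((hasDerivAt_pow 3 x).div_const 3).congr_deriv (by norm_num)
    have h₁ : HasDerivAt (fun τ : ℝ => τ • a) a x := by
      simpa using (hasDerivAt_id x).smul_const a
    exact (h₁.add (h₂.smul_const b)).add (h₃.smul_const c)
  rw [intervalIntegral.integral_eq_sub_of_hasDerivAt (fun x _ => hderiv x)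
    (Continuous.intervalIntegrable (by fun_prop) _ _)]
  simp

/-- Properties of the optimal intercept trajectory: (i) it reaches the target,
`r(t_f) = r_f`; (ii) `u*(t_f) = 0` and `u*(0) = −3[Δ_r + v_{g0} t_f]/t_f² − (3/2)k`;
(iii) the free terminal velocity is
`v_g(t_f) = v_{g0} − (3/2)[Δ_r + v_{g0} t_f]/t_f + (1/4) k t_f`. -/
theorem statement_8
    (tf : ℝ) (htf : 0 < tf)
    (r0 rf vg0 w0 k : EuclideanSpace ℝ (Fin 3))
    (w : ℝ → EuclideanSpace ℝ (Fin 3)) (hw : ∀ t, w t = w0 + t • k)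
    (Dr : EuclideanSpace ℝ (Fin 3)) (hDr : Dr = r0 - rf)
    (ustar : ℝ → EuclideanSpace ℝ (Fin 3))
    (hustar : ∀ t, ustar t =
      ((t - tf) * (3 / tf ^ 3)) • (Dr + tf • vg0 + (tf ^ 2 / 2) • k))
    (vg r : ℝ → EuclideanSpace ℝ (Fin 3))
    (hvg : ∀ t, vg t = vg0 + ∫ τ in (0:ℝ)..t, (ustar τ + k))
    (hr : ∀ t, r t = r0 + ∫ τ in (0:ℝ)..t, vg τ) :
    r tf = rf ∧
    ustar tf = 0 ∧
    ustar 0 = -((3 / tf ^ 2) • (Dr + tf • vg0)) - (3/2 : ℝ) • k ∧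
    vg tf = vg0 - ((3 / (2 * tf)) • (Dr + tf • vg0)) + ((1/4 : ℝ) * tf) • k := by
  subst hDr
  have htf0 : tf ≠ 0 := htf.ne'
  obtain ⟨A, hA⟩ : ∃ A, A = r0 - rf + tf • vg0 + (tf ^ 2 / 2) • k := ⟨_, rfl⟩
  simp_rw [← hA] at hustar
  have hvg' (t : ℝ) : vg t =
      vg0 + t • (k - (3 / tf ^ 2) • A) + t ^ 2 • ((3 / (2 * tf ^ 3)) • A) := by
    have hu (τ : ℝ) : ustar τ + k =
        (k - (3 / tf ^ 2) • A) + τ • ((3 / tf ^ 3) • A) + τ ^ 2 • 0 := by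
      rw [hustar]
      match_scalars <;> field_simp
      ring
    simp_rw [hvg, hu]
    rw [integral_quadratic_smul]
    match_scalars <;> field_simp
  refine ⟨?_, ?_, ?_, ?_⟩
  · simp_rw [hr, hvg']
    rw [integral_quadratic_smul, hA]
    match_scalars <;> field_simp <;> ring
  · simp [hustar]
  · rw [hustar, hA]
    match_scalars <;> field_simp <;> ring
  · rw [hvg', hA]
    match_scalars <;> field_simp <;> ring
end

section
/- Fix vectors r_0, r_f, v_{g0}, w_0, k in ℝ³, a constant C_I ≥ 0, let the wind be w(t) = w_0 + k t, set Δ_r = r_0 − r_f, and for each t_f > 0 let u*_{t_f}(t) = (t − t_f)·(3/t_f³)[Δ_r + v_{g0} t_f + (k/2) t_f²] be the optimal intercept control. Then the intercept cost J(t_f) = ∫₀^{t_f}(½‖u*_{t_f}(t)‖² + C_I)dt equals (C_I + (3/8)‖k‖²) t_f + (3/2)⟨v_{g0}, k⟩ + (3/2)(‖v_{g0}‖² + ⟨Δ_r, k⟩) t_f^{−1} + 3⟨Δ_r, v_{g0}⟩ t_f^{−2} + (3/2)‖Δ_r‖² t_f^{−3}, and its derivative satisfies t_f⁴ · J'(t_f)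 = (C_I + (3/8)‖k‖²) t_f⁴ − (3/2)(‖v_{g0}‖² + ⟨Δ_r, k⟩) t_f² − 6⟨Δ_r, v_{g0}⟩ t_f − (9/2)‖Δ_r‖² for all t_f > 0. -/
open scoped RealInnerProductSpace

theorem norm_add_smul_add_smul_sq {E : Type*} [NormedAddCommGroup E] [InnerProductSpace ℝ E]
    (x y z : E) (a b : ℝ) :
    ‖x + a • y + b • z‖ ^ 2 = ‖x‖ ^ 2 + a ^ 2 * ‖y‖ ^ 2 + b ^ 2 * ‖z‖ ^ 2
      + 2 * a * ⟪x, y⟫ + 2 * b * ⟪x, z⟫ + 2 * a * b * ⟪y, z⟫ := by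
  rw [norm_add_sq_real, norm_add_sq_real, inner_add_left]
  simp only [real_inner_smul_left, real_inner_smul_right, norm_smul, mul_pow, Real.norm_eq_abs,
    sq_abs]
  ring

theorem integral_half_norm_sq_linear_smul_add {E : Type*} [NormedAddCommGroup E]
    [NormedSpace ℝ E] (p : E) (T a C : ℝ) :
    ∫ t in (0:ℝ)..T, ((1/2) * ‖((t - T) * a) • p‖ ^ 2 + C)
      = a ^ 2 * T ^ 3 / 6 * ‖p‖ ^ 2 + C * T := by
  have hderiv : ∀ t ∈ Set.uIcc (0:ℝ) T,
      HasDerivAt (fun t : ℝ => (t - T) ^ 3 * (a ^ 2 * ‖p‖ ^ 2 / 6) + C * t)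
        ((1/2) * ‖((t - T) * a) • p‖ ^ 2 + C) t := by
    intro t _
    refine (((((hasDerivAt_id t).sub_const T).pow 3).mul_const (a ^ 2 * ‖p‖ ^ 2 / 6)).add
      ((hasDerivAt_id t).const_mul C)).congr_deriv ?_
    simp only [norm_smul, mul_pow, Real.norm_eq_abs, sq_abs, abs_mul, id]
    push_cast
    ring
  rw [intervalIntegral.integral_eq_sub_of_hasDerivAt hderiv
    (Continuous.intervalIntegrable (by fun_prop) _ _)]
  ring

theorem hasDerivAt_mul_add_add_div_add_div_sq_add_div_cube (a b c d e : ℝ) {x : ℝ} (hx : x ≠ 0) :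
    HasDerivAt (fun x : ℝ => a * x + b + c / x + d / x ^ 2 + e / x ^ 3)
      (a - c / x ^ 2 - 2 * d / x ^ 3 - 3 * e / x ^ 4) x := by
  have hid := hasDerivAt_id x
  refine (((((hid.const_mul a).add_const b).add ((hasDerivAt_const x c).div hid hx)).add
    ((hasDerivAt_const x d).div (hid.pow 2) (pow_ne_zero 2 hx))).add
    ((hasDerivAt_const x e).div (hid.pow 3) (pow_ne_zero 3 hx))).congr_deriv ?_
  simp only [id, Pi.pow_apply]
  push_cast
  field_simp
  ring

/-- The intercept cost `J(t_f) = ∫₀^{t_f} (½‖u*_{t_f}(t)‖² + C_I) dt` equals the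
stated closed-form expression, and `t_f⁴ J'(t_f)` equals the stated quartic polynomial, for
all `t_f > 0`. -/
theorem statement_9
    (r0 rf vg0 w0 k : EuclideanSpace ℝ (Fin 3))
    (CI : ℝ) (hCI : 0 ≤ CI)
    (w : ℝ → EuclideanSpace ℝ (Fin 3)) (hw : ∀ t, w t = w0 + t • k)
    (Dr : EuclideanSpace ℝ (Fin 3)) (hDr : Dr = r0 - rf)
    (J : ℝ → ℝ)
    (hJ : ∀ T, J T = ∫ t in (0:ℝ)..T,
      ((1/2) * ‖((t - T) * (3 / T ^ 3)) • (Dr + T • vg0 + (T ^ 2 / 2) • k)‖ ^ 2 + CI)) :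
    ∀ tf : ℝ, 0 < tf →
      J tf = (CI + (3/8) * ‖k‖ ^ 2) * tf + (3/2) * ⟪vg0, k⟫
        + (3/2) * (‖vg0‖ ^ 2 + ⟪Dr, k⟫) / tf
        + 3 * ⟪Dr, vg0⟫ / tf ^ 2 + (3/2) * ‖Dr‖ ^ 2 / tf ^ 3 ∧
      tf ^ 4 * deriv J tf = (CI + (3/8) * ‖k‖ ^ 2) * tf ^ 4
        - (3/2) * (‖vg0‖ ^ 2 + ⟪Dr, k⟫) * tf ^ 2
        - 6 * ⟪Dr, vg0⟫ * tf - (9/2) * ‖Dr‖ ^ 2 := by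
  have hcost : ∀ T : ℝ, 0 < T → J T = (CI + (3/8) * ‖k‖ ^ 2) * T + (3/2) * ⟪vg0, k⟫
      + (3/2) * (‖vg0‖ ^ 2 + ⟪Dr, k⟫) / T
      + 3 * ⟪Dr, vg0⟫ / T ^ 2 + (3/2) * ‖Dr‖ ^ 2 / T ^ 3 := by
    intro T hT
    rw [hJ, integral_half_norm_sq_linear_smul_add, norm_add_smul_add_smul_sq]
    field_simp
    ring
  intro tf htf
  refine ⟨hcost tf htf, ?_⟩
  have heq : J =ᶠ[nhds tf] fun T => (CI + (3/8) * ‖k‖ ^ 2) * T + (3/2) * ⟪vg0, k⟫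
      + (3/2) * (‖vg0‖ ^ 2 + ⟪Dr, k⟫) / T
      + 3 * ⟪Dr, vg0⟫ / T ^ 2 + (3/2) * ‖Dr‖ ^ 2 / T ^ 3 := by
    filter_upwards [lt_mem_nhds htf] with T hT using hcost T hT
  rw [heq.deriv_eq,
    (hasDerivAt_mul_add_add_div_add_div_sq_add_div_cube _ _ _ _ _ htf.ne').deriv]
  field_simp
  ring
end

section
/- Fix t_f > 0, vectors r_0, r_f, v_{g0}, w_0, k in ℝ³, wind w(t) = w_0 + kt, set Δ_r = r_0 − r_f, and let u* be the optimal intercept control u*(t) = (t − t_f)·(3/t_f³)[Δ_r + v_{g0} t_f + (k/2) t_f²], with trajectory v_g(t) = v_{g0} + ∫₀^t (u*(τ) + k)dτ, r(t) = r_0 + ∫₀^t v_g(τ)dτ. For t ∈ [0, t_f), set t_go = t_f − t and ZEM(t) = r_f − [r(t) + v_g(t) t_go + (k/2) t_go²]. Then along the optimal trajectory the open-loop control coincides with the ZEM feedback law: u*(t) = (3/t_go²) ZEM(t) for every t ∈ [0, t_f). -/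
theorem intervalIntegral_quadratic {E : Type*} [NormedAddCommGroup E] [NormedSpace ℝ E]
    [CompleteSpace E] (x y z : E) (t : ℝ) :
    ∫ τ in (0:ℝ)..t, (x + τ • y + τ ^ 2 • z) =
      t • x + (t ^ 2 / 2) • y + (t ^ 3 / 3) • z := by
  have hderiv : ∀ τ ∈ Set.uIcc 0 t, HasDerivAt
      (fun τ : ℝ => τ • x + (τ ^ 2 / 2) • y + (τ ^ 3 / 3) • z)
      (x + τ • y + τ ^ 2 • z) τ := by
    intro τ _
    have h2 := (((hasDerivAt_id τ).pow 2).div_const 2).smul_const y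
    have h3 := (((hasDerivAt_id τ).pow 3).div_const 3).smul_const z
    convert (((hasDerivAt_id τ).smul_const x).add h2).add h3 using 1
    · rfl
    · norm_num
  rw [intervalIntegral.integral_eq_sub_of_hasDerivAt hderiv
    (Continuous.intervalIntegrable (by fun_prop) _ _)]
  simp

/-- Along the optimal intercept trajectory under wind `w(t) = w₀ + k t`, the
open-loop optimal control coincides with the ZEM feedback law `u*(t) = (3/t_go²) ZEM(t)`
for all `t ∈ [0, t_f)`. -/
theorem statement_11
    (tf : ℝ) (htf : 0 < tf)
    (r0 rf vg0 w0 k : EuclideanSpace ℝ (Fin 3))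
    (w : ℝ → EuclideanSpace ℝ (Fin 3)) (hw : ∀ t, w t = w0 + t • k)
    (Dr : EuclideanSpace ℝ (Fin 3)) (hDr : Dr = r0 - rf)
    (ustar : ℝ → EuclideanSpace ℝ (Fin 3))
    (hustar : ∀ t, ustar t =
      ((t - tf) * (3 / tf ^ 3)) • (Dr + tf • vg0 + (tf ^ 2 / 2) • k))
    (vg r : ℝ → EuclideanSpace ℝ (Fin 3))
    (hvg : ∀ t, vg t = vg0 + ∫ τ in (0:ℝ)..t, (ustar τ + k))
    (hr : ∀ t, r t = r0 + ∫ τ in (0:ℝ)..t, vg τ)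
    (ZEM : ℝ → EuclideanSpace ℝ (Fin 3))
    (hZEM : ∀ t, ZEM t =
      rf - (r t + (tf - t) • vg t + ((tf - t) ^ 2 / 2) • k)) :
    ∀ t ∈ Set.Ico (0:ℝ) tf,
      ustar t = (3 / (tf - t) ^ 2) • ZEM t := by
  set C := Dr + tf • vg0 + (tf ^ 2 / 2) • k with hC
  clear_value C
  have hv : ∀ t, vg t = vg0 + t • (k - (3 / tf ^ 2) • C) + t ^ 2 • ((3 / (2 * tf ^ 3)) • C) := by
    intro t
    have h : ∀ τ, ustar τ + k =
        (k - (3 / tf ^ 2) • C) + τ • ((3 / tf ^ 3) • C) + τ ^ 2 • 0 := by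
      intro τ
      rw [hustar]
      match_scalars <;> field_simp
      ring
    simp only [hvg, h, intervalIntegral_quadratic]
    match_scalars <;> field_simp
  have hZ : ∀ t, ZEM t = (-(tf - t) ^ 3 / tf ^ 3) • C := by
    intro t
    simp only [hZEM, hr, hv, intervalIntegral_quadratic]
    have hrf : rf = r0 + tf • vg0 + (tf ^ 2 / 2) • k - C := by
      rw [hC, hDr]
      module
    rw [hrf]
    match_scalars <;> field_simp <;> ring
  intro t ht
  have hgo : tf - t ≠ 0 := (sub_pos.mpr ht.2).ne'
  rw [hustar, hZ, smul_smul]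
  congr 1
  field_simp
  ring
end

section
/- Let x_0, v_{gx0}, v_{gy0} be real numbers with x_0 · v_{gx0} < 0. Consider the minimum-energy (C_I = 0) rendez-vous time-optimality quadratic Q(t) = −(3 v_{gx0}² + v_{gy0}²) t² − 12 (x_0 v_{gx0}) t − 9 x_0². Then Q has a positive real root if and only if v_{gy0}² ≤ v_{gx0}² (i.e., the initial velocity heading satisfies |θ| ≤ 45 degrees); moreover, when v_{gy0}² = v_{gx0}², Q has the unique (double) positive root t = (3/2)(−x_0 / v_{gx0}). -/
/-- The minimum-energy (`C_I = 0`) rendez-vous time-optimality quadratic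
`Q(t) = −(3 v_{gx0}² + v_{gy0}²) t² − 12 (x₀ v_{gx0}) t − 9 x₀²` has a positive real root
iff `v_{gy0}² ≤ v_{gx0}²` (i.e. `|θ| ≤ 45°`); when `v_{gy0}² = v_{gx0}²`, its unique
(double) positive root is `t = (3/2)(−x₀/v_{gx0})`. -/
theorem statement_12
    (x0 vgx0 vgy0 : ℝ) (h : x0 * vgx0 < 0)
    (Q : ℝ → ℝ)
    (hQ : ∀ t, Q t = -(3 * vgx0 ^ 2 + vgy0 ^ 2) * t ^ 2
      - 12 * (x0 * vgx0) * t - 9 * x0 ^ 2) :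
    ((∃ t : ℝ, 0 < t ∧ Q t = 0) ↔ vgy0 ^ 2 ≤ vgx0 ^ 2) ∧
    (vgy0 ^ 2 = vgx0 ^ 2 →
      0 < (3/2) * (-x0 / vgx0) ∧
      ∀ t : ℝ, Q t = 0 ↔ t = (3/2) * (-x0 / vgx0)) := by
  have hx : x0 ≠ 0 := left_ne_zero_of_mul h.ne
  have hv : vgx0 ≠ 0 := right_ne_zero_of_mul h.ne
  have hA : 0 < 3 * vgx0 ^ 2 + vgy0 ^ 2 := by positivity
  have complete_square : ∀ t, (3 * vgx0 ^ 2 + vgy0 ^ 2) * Q t =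
      9 * x0 ^ 2 * (vgx0 ^ 2 - vgy0 ^ 2)
        - ((3 * vgx0 ^ 2 + vgy0 ^ 2) * t + 6 * (x0 * vgx0)) ^ 2 := by
    intro t
    rw [hQ]
    ring
  refine ⟨⟨?_, fun hle => ?_⟩, fun heq => ⟨?_, fun t => ?_⟩⟩
  · rintro ⟨t, -, ht⟩
    have hsq := complete_square t
    rw [ht, mul_zero] at hsq
    have hdisc : 0 ≤ 9 * x0 ^ 2 * (vgx0 ^ 2 - vgy0 ^ 2) := by
      linarith [sq_nonneg ((3 * vgx0 ^ 2 + vgy0 ^ 2) * t + 6 * (x0 * vgx0))]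
    exact sub_nonneg.mp (nonneg_of_mul_nonneg_right hdisc (by positivity))
  · have hs := Real.sq_sqrt (sub_nonneg.mpr hle)
    set s := √(vgx0 ^ 2 - vgy0 ^ 2)
    have hs0 : 0 ≤ |x0| * s := by positivity
    refine ⟨(-6 * (x0 * vgx0) + 3 * (|x0| * s)) / (3 * vgx0 ^ 2 + vgy0 ^ 2),
      div_pos (by linarith) hA, ?_⟩
    refine (mul_eq_zero.mp ?_).resolve_left hA.ne'
    rw [complete_square, mul_div_cancel₀ _ hA.ne', ← hs, ← sq_abs x0]
    ring
  · have : -x0 / vgx0 = -(x0 * vgx0) / vgx0 ^ 2 := by field_simp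
    rw [this]
    have : 0 < -(x0 * vgx0) := neg_pos.mpr h
    positivity
  · have hdouble : Q t = -(2 * vgx0 * t + 3 * x0) ^ 2 := by
      rw [hQ, heq]
      ring
    rw [hdouble, neg_eq_zero, sq_eq_zero_iff]
    constructor
    · intro ht
      field_simp
      linarith
    · rintro rfl
      field_simp
      ring
end

section
/- Let x_0, v_{gx0}, v_{gy0} be real numbers with x_0 · v_{gx0} < 0. Consider the minimum-energy (C_I = 0) intercept time-optimality quadratic Q(t) = −3(v_{gx0}² + v_{gy0}²) t² − 12 (x_0 v_{gx0}) t − 9 x_0². Then Q has a positive real root if and only if 3 v_{gy0}² ≤ v_{gx0}² (i.e., |v_{gy0}| ≤ |v_{gx0}|/√3, equivalently the initial velocity heading satisfies |θ| ≤ 30 degrees); moreover, when 3 v_{gy0}² = v_{gx0}², Q has the unique (double) positive root t = (3/2)(−x_0 / v_{gx0}). -/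
/-- The minimum-energy (`C_I = 0`) intercept time-optimality quadratic
`Q(t) = −3(v_{gx0}² + v_{gy0}²) t² − 12 (x₀ v_{gx0}) t − 9 x₀²` has a positive real root
iff `3 v_{gy0}² ≤ v_{gx0}²` (i.e. `|θ| ≤ 30°`); when `3 v_{gy0}² = v_{gx0}²`, its unique
(double) positive root is `t = (3/2)(−x₀/v_{gx0})`. -/
theorem statement_13
    (x0 vgx0 vgy0 : ℝ) (h : x0 * vgx0 < 0)
    (Q : ℝ → ℝ)
    (hQ : ∀ t, Q t = -3 * (vgx0 ^ 2 + vgy0 ^ 2) * t ^ 2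
      - 12 * (x0 * vgx0) * t - 9 * x0 ^ 2) :
    ((∃ t : ℝ, 0 < t ∧ Q t = 0) ↔ 3 * vgy0 ^ 2 ≤ vgx0 ^ 2) ∧
    (3 * vgy0 ^ 2 = vgx0 ^ 2 →
      0 < (3/2) * (-x0 / vgx0) ∧
      ∀ t : ℝ, Q t = 0 ↔ t = (3/2) * (-x0 / vgx0)) := by
  have hx : x0 ≠ 0 := left_ne_zero_of_mul h.ne
  have hv : vgx0 ≠ 0 := right_ne_zero_of_mul h.ne
  have hx2 : 0 < x0 ^ 2 := by positivity
  have ha : 0 < vgx0 ^ 2 + vgy0 ^ 2 := by positivity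
  refine ⟨⟨?_, fun hle => ?_⟩, fun heq => ⟨?_, fun t => ?_⟩⟩
  · rintro ⟨t, -, ht⟩
    rw [hQ] at ht
    have hsq : ((vgx0 ^ 2 + vgy0 ^ 2) * t + 2 * (x0 * vgx0)) ^ 2
        = x0 ^ 2 * (vgx0 ^ 2 - 3 * vgy0 ^ 2) := by
      linear_combination (-(vgx0 ^ 2 + vgy0 ^ 2) / 3) * ht
    have hnonneg : 0 ≤ x0 ^ 2 * (vgx0 ^ 2 - 3 * vgy0 ^ 2) := hsq ▸ sq_nonneg _
    linarith [nonneg_of_mul_nonneg_right hnonneg hx2]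
  · have hs := Real.sq_sqrt (mul_nonneg hx2.le (sub_nonneg.2 hle))
    have hs0 := Real.sqrt_nonneg (x0 ^ 2 * (vgx0 ^ 2 - 3 * vgy0 ^ 2))
    set s := √(x0 ^ 2 * (vgx0 ^ 2 - 3 * vgy0 ^ 2))
    refine ⟨(-2 * (x0 * vgx0) + s) / (vgx0 ^ 2 + vgy0 ^ 2), div_pos (by linarith) ha, ?_⟩
    rw [hQ]
    field_simp
    linear_combination (-3) * hs
  · have hdiv : -x0 / vgx0 = -(x0 * vgx0) / vgx0 ^ 2 := by field_simp
    rw [hdiv]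
    have hneg : 0 < -(x0 * vgx0) := neg_pos.2 h
    positivity
  · have hfac : Q t = -(2 * vgx0 * t + 3 * x0) ^ 2 := by
      rw [hQ]
      linear_combination (-t ^ 2) * heq
    rw [hfac, neg_eq_zero, sq_eq_zero_iff, mul_div_assoc', eq_div_iff hv]
    constructor <;> intro ht <;> linarith
end

section
/- Consider the 1D rendez-vous problem with constant wind (ẇ = 0): initial position x_0 ≠ 0, target at the origin, initial velocity v_0 with x_0 v_0 < 0, zero prescribed terminal velocity, final time t_f > 0, and optimal velocity profile v(t) = v_0 + (t²/2) p_r − t p_{v0} where p_r = 6(2x_0 + v_0 t_f)/t_f³ and p_{v0} = 2(3x_0 + 2 v_0 t_f)/t_f². If t_f > 3(−x_0/v_0), then the motion reverses: there exists t ∈ (0, t_f) with v(t) · v_0 < 0, i.e., the velocity changes sign during the maneuver. -/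
/-- 1D rendez-vous with constant wind, zero prescribed terminal velocity: if
`t_f > 3(−x₀/v₀)` (i.e. K > 3), the optimal motion reverses — there is a time
`t ∈ (0, t_f)` at which the optimal velocity has sign opposite to `v₀`. -/
theorem statement_16
    (x0 v0 tf : ℝ) (hx0 : x0 ≠ 0) (hsign : x0 * v0 < 0) (htf : 0 < tf)
    (pr pv0 : ℝ)
    (hpr : pr = 6 * (2 * x0 + v0 * tf) / tf ^ 3)
    (hpv0 : pv0 = 2 * (3 * x0 + 2 * v0 * tf) / tf ^ 2)
    (v : ℝ → ℝ)
    (hv : ∀ t, v t = v0 + (t ^ 2 / 2) * pr - t * pv0)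
    (hK : tf > 3 * (-x0 / v0)) :
    ∃ t ∈ Set.Ioo 0 tf, v t * v0 < 0 := by
  have hv0 : v0 ≠ 0 := right_ne_zero_of_mul hsign.ne
  have hsq : 0 < v0 ^ 2 := by positivity
  -- In the time fraction `s = t / tf`, `v * v0` factors as `(1 - s) * (v0 ^ 2 - s * a)`.
  obtain ⟨a, ha⟩ : ∃ a, a = 3 * v0 ^ 2 + 6 * (x0 * v0) / tf := ⟨_, rfl⟩
  have hfactor : ∀ s, v (s * tf) * v0 = (1 - s) * (v0 ^ 2 - s * a) := by
    intro s
    rw [hv, hpr, hpv0, ha]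
    field_simp
    ring
  have hK' : -(3 * (x0 * v0)) < tf * v0 ^ 2 := by
    calc -(3 * (x0 * v0)) = 3 * (-x0 / v0) * v0 ^ 2 := by field_simp
      _ < tf * v0 ^ 2 := mul_lt_mul_of_pos_right hK hsq
  have hlt : v0 ^ 2 < a := by
    have h : 0 < 2 * (tf * v0 ^ 2 + 3 * (x0 * v0)) / tf := div_pos (by linarith) htf
    have h' : a - v0 ^ 2 = 2 * (tf * v0 ^ 2 + 3 * (x0 * v0)) / tf := by
      rw [ha]
      field_simp
      ring
    linarith
  have ha0 : 0 < a := hsq.trans hlt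
  obtain ⟨s, hs, hs1⟩ := exists_between ((div_lt_one ha0).2 hlt)
  have hs0 : 0 < s := (div_pos hsq ha0).trans hs
  refine ⟨s * tf, ⟨mul_pos hs0 htf, mul_lt_of_lt_one_left htf hs1⟩, ?_⟩
  rw [hfactor]
  exact mul_neg_of_pos_of_neg (sub_pos.2 hs1) (sub_neg.2 ((div_lt_iff₀ ha0).1 hs))
end
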